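/- Let H be a minimal counterexample to the main theorem: a plane graph with Δ(H)=6, containing no subgraph isomorphic to a diamond or a house, in which every 6-vertex either is not incident with two 4-cycles sharing an edge or is not incident with three cycles of sizes p,q,ℓ for any {p,q,ℓ} ∈ {{3,4,4},{3,3,4}}, that is not totally 7-colorable, and that minimizes |V(H)|+|E(H)| among all such graphs. Then H has no (3,5,3,5)-face, i.e., no 4-face whose incident vertices in cyclic order along the boundary have degrees 3, 5, 3, 5. -/

import Mathlib

open SimpleGraph

/-- The degree of a vertex, as `Nat.card` of its neighbor set. -/
noncomputable def vdeg {V : Type*} (G : SimpleGraph V) (v : V) : ℕ :=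
  Nat.card (G.neighborSet v)

/-- `G` has maximum degree exactly `k`. -/
def MaxDegreeEq {V : Type*} (G : SimpleGraph V) (k : ℕ) : Prop :=
  (∀ v, vdeg G v ≤ k) ∧ ∃ v, vdeg G v = k

/-- `G` admits a total `k`-coloring: a coloring of vertices and edges with `k` colors such
that adjacent vertices get distinct colors, edges sharing an endpoint get distinct colors,
and each edge gets a color distinct from those of its endpoints. -/
def TotallyColorable {V : Type*} (G : SimpleGraph V) (k : ℕ) : Prop :=
  ∃ (cv : V → Fin k) (ce : Sym2 V → Fin k),
    (∀ ⦃u v⦄, G.Adj u v → cv u ≠ cv v) ∧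
    (∀ e₁ ∈ G.edgeSet, ∀ e₂ ∈ G.edgeSet, e₁ ≠ e₂ → (∃ x, x ∈ e₁ ∧ x ∈ e₂) →
      ce e₁ ≠ ce e₂) ∧
    (∀ ⦃u v⦄, G.Adj u v → ce s(u, v) ≠ cv u)

/-- The diamond: `K₄` minus one edge. -/
def diamondGraph : SimpleGraph (Fin 4) :=
  SimpleGraph.fromEdgeSet {s(0, 1), s(0, 2), s(0, 3), s(1, 2), s(1, 3)}

/-- The house: a `4`-cycle `1 2 3 4` and a triangle `0 1 4` sharing exactly the edge `{1,4}`
(equivalently, a `5`-cycle plus one chord). -/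
def houseGraph : SimpleGraph (Fin 5) :=
  SimpleGraph.fromEdgeSet {s(0, 1), s(1, 2), s(2, 3), s(3, 4), s(4, 0), s(1, 4)}

/-- `G` contains a (not necessarily induced) subgraph isomorphic to `H`. -/
def ContainsCopy {α β : Type*} (H : SimpleGraph α) (G : SimpleGraph β) : Prop :=
  ∃ f : α → β, Function.Injective f ∧ ∀ ⦃u v⦄, H.Adj u v → G.Adj (f u) (f v)

/-- `v` is incident with two distinct `4`-cycles of `G` that share an edge. -/
def TwoAdjacentFourCyclesAt {V : Type*} (G : SimpleGraph V) (v : V) : Prop :=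
  ∃ (c₁ c₂ : G.Walk v v), c₁.IsCycle ∧ c₂.IsCycle ∧ c₁.length = 4 ∧ c₂.length = 4 ∧
    {e | e ∈ c₁.edges} ≠ {e | e ∈ c₂.edges} ∧ ∃ e, e ∈ c₁.edges ∧ e ∈ c₂.edges

/-- `v` is incident with three pairwise distinct cycles of `G`, of lengths `p`, `q`, `ℓ`. -/
def ThreeCyclesAt {V : Type*} (G : SimpleGraph V) (v : V) (p q ℓ : ℕ) : Prop :=
  ∃ (c₁ c₂ c₃ : G.Walk v v), c₁.IsCycle ∧ c₂.IsCycle ∧ c₃.IsCycle ∧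
    c₁.length = p ∧ c₂.length = q ∧ c₃.length = ℓ ∧
    {e | e ∈ c₁.edges} ≠ {e | e ∈ c₂.edges} ∧
    {e | e ∈ c₁.edges} ≠ {e | e ∈ c₃.edges} ∧
    {e | e ∈ c₂.edges} ≠ {e | e ∈ c₃.edges}

/-- Every `6`-vertex of `G` is not incident with two `4`-cycles sharing an edge, or is not
incident with three cycles of sizes `p, q, ℓ` for any `{p,q,ℓ} ∈ {{3,4,4},{3,3,4}}`. -/
def Good6Vertices {V : Type*} (G : SimpleGraph V) : Prop :=
  ∀ v, vdeg G v = 6 →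
    (¬ TwoAdjacentFourCyclesAt G v) ∨
    (∀ p q ℓ : ℕ, (({p, q, ℓ} : Multiset ℕ) = {3, 4, 4} ∨ ({p, q, ℓ} : Multiset ℕ) = {3, 3, 4}) →
      ¬ ThreeCyclesAt G v p q ℓ)

/-- Reversal of darts, as a permutation. -/
def dartRev {V : Type*} (G : SimpleGraph V) : Equiv.Perm G.Dart :=
  Function.Involutive.toPerm SimpleGraph.Dart.symm SimpleGraph.Dart.symm_involutive

/-- A rotation system (combinatorial embedding) of `G`: a permutation of the darts whose
orbits are exactly the sets of darts emanating from each single vertex. -/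
structure RotationSystem {V : Type*} (G : SimpleGraph V) where
  σ : Equiv.Perm G.Dart
  tail_fixed : ∀ d : G.Dart, (σ d).fst = d.fst
  vertex_cycles : ∀ d d' : G.Dart, d.fst = d'.fst → σ.SameCycle d d'

namespace RotationSystem

variable {V : Type*} {G : SimpleGraph V}

/-- The face-tracing permutation of a rotation system. -/
def φ (R : RotationSystem G) : Equiv.Perm G.Dart :=
  R.σ * dartRev G

/-- Two darts lie on the same face iff they are in the same orbit of the face-tracing
permutation. -/
def faceSetoid (R : RotationSystem G) : Setoid G.Dart where
  r := R.φ.SameCycle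
  iseqv := ⟨fun d => Equiv.Perm.SameCycle.refl _ d, Equiv.Perm.SameCycle.symm,
    Equiv.Perm.SameCycle.trans⟩

/-- The faces of the embedding: orbits of the face-tracing permutation. -/
def Faces (R : RotationSystem G) : Type _ :=
  Quotient R.faceSetoid

/-- The number of faces of the embedding. -/
noncomputable def numFaces (R : RotationSystem G) : ℕ :=
  Nat.card R.Faces

/-- The darts of the face containing the dart `d`. -/
def faceDarts (R : RotationSystem G) (d : G.Dart) : Set G.Dart :=
  {d' | R.φ.SameCycle d d'}

/-- The degree (length of the boundary walk, cut edges counted twice) of the face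
containing the dart `d`. -/
noncomputable def faceDeg (R : RotationSystem G) (d : G.Dart) : ℕ :=
  (R.faceDarts d).ncard

/-- The vertex `v` is incident with the face containing the dart `d`. -/
def FaceIncident (R : RotationSystem G) (v : V) (d : G.Dart) : Prop :=
  ∃ d' ∈ R.faceDarts d, d'.fst = v

/-- A rotation system is a plane embedding when it satisfies Euler's formula
`|V| - |E| + |F| = 2` on each connected component, i.e. `|V| + |F| = |E| + 2c`. -/
def IsPlanarEmbedding [Fintype V] (R : RotationSystem G) : Prop :=
  Fintype.card V + R.numFaces = Nat.card G.edgeSet + 2 * Nat.card G.ConnectedComponent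

end RotationSystem

/-- A graph is planar if it admits a plane embedding. -/
def IsPlanar {V : Type*} [Fintype V] (G : SimpleGraph V) : Prop :=
  ∃ R : RotationSystem G, R.IsPlanarEmbedding

/-- Conditions (1), (2), (3) on graphs in Theorem 1: planar of maximum degree 6, with no
diamond and no house subgraph, and every 6-vertex not incident with two adjacent 4-cycles
or not incident with three cycles of sizes in `{{3,4,4},{3,3,4}}`. -/
def GoodGraph {V : Type*} [Fintype V] (G : SimpleGraph V) : Prop :=
  IsPlanar G ∧ MaxDegreeEq G 6 ∧ ¬ ContainsCopy diamondGraph G ∧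
    ¬ ContainsCopy houseGraph G ∧ Good6Vertices G

/-- `H` is a minimal counterexample to the main theorem: it satisfies conditions (1)–(3),
is not totally 7-colorable, and minimizes `|V| + |E|` among all such graphs. -/
def MinimalCounterexample {V : Type*} [Fintype V] (H : SimpleGraph V) : Prop :=
  GoodGraph H ∧ ¬ TotallyColorable H 7 ∧
    ∀ (n : ℕ) (G : SimpleGraph (Fin n)), GoodGraph G → ¬ TotallyColorable G 7 →
      Fintype.card V + Nat.card H.edgeSet ≤ n + Nat.card G.edgeSet

section Aux
open Equiv Equiv.Perm

/-- number of cycles -/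
noncomputable def cycCount {D : Type*} (f : Perm D) : ℕ := Nat.card (Quotient (SameCycle.setoid f))

theorem quot_J1 {D : Type*} [Finite D] (S T : Setoid D) (a b : D) (hST : ∀ x y, S x y → T x y)
    (h : ∀ x y, T x y → S x y ∨ ((S x a ∨ S x b) ∧ (S y a ∨ S y b))) :
    Nat.card (Quotient S) ≤ Nat.card (Quotient T) + 1 := by
  classical
  rw [← Finite.card_option]
  let F : Quotient S → Option (Quotient T) := fun q =>
    if q = Quotient.mk S b then none
    else some (Quotient.map' (s₁ := S) (s₂ := T) id (fun x y hxy => hST x y hxy) q)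
  refine Nat.card_le_card_of_injective F ?_
  intro q r
  refine Quotient.inductionOn₂ q r ?_
  intro x y hxy
  by_cases hx : Quotient.mk S x = Quotient.mk S b
  · by_cases hy : Quotient.mk S y = Quotient.mk S b
    · rw [hx, hy]
    · simp [F, hx, hy] at hxy
  · by_cases hy : Quotient.mk S y = Quotient.mk S b
    · simp [F, hx, hy] at hxy
    · simp only [F, hx, hy, if_false, Option.some.injEq] at hxy
      have h1 : T x y := Quotient.exact hxy
      have hx' : ¬ S x b := fun h => hx (Quotient.sound h)
      have hy' : ¬ S y b := fun h => hy (Quotient.sound h)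
      apply Quotient.sound
      rcases h x y h1 with h2 | ⟨h2, h3⟩
      · exact h2
      · exact S.trans (h2.resolve_right hx') (S.symm (h3.resolve_right hy'))

theorem quot_J2 {D : Type*} [Finite D] (S T : Setoid D) (a b : D) (hST : ∀ x y, S x y → T x y)
    (h1 : T a b) (h2 : ¬ S a b) :
    Nat.card (Quotient T) + 1 ≤ Nat.card (Quotient S) := by
  classical
  have := Fintype.ofFinite (Quotient S)
  have := Fintype.ofFinite (Quotient T)
  rw [Nat.card_eq_fintype_card, Nat.card_eq_fintype_card]
  refine Fintype.card_lt_of_surjective_not_injective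
    (Quotient.map' (s₁ := S) (s₂ := T) id (fun x y hxy => hST x y hxy)) ?_ ?_
  · intro q
    refine Quotient.inductionOn q ?_
    intro x
    exact ⟨Quotient.mk S x, rfl⟩
  · intro hinj
    apply h2
    have : Quotient.mk S a = Quotient.mk S b := hinj (Quotient.sound h1)
    exact Quotient.exact this

theorem sameCycle_of_step {D : Type*} [Finite D] (g : Perm D) (Q : D → D → Prop)
    (hr : ∀ x, Q x x) (ht : ∀ x y z, Q x y → Q y z → Q x z) (hs : ∀ x, Q x (g x))
    {x y : D} (h : SameCycle g x y) : Q x y := by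
  obtain ⟨n, hn, rfl⟩ := h.exists_pow_eq'
  clear h hn
  induction n with
  | zero => exact hr x
  | succ n ih =>
    rw [pow_succ']
    exact ht _ _ _ ih (hs _)

theorem swap_merge {D : Type*} [Finite D] [DecidableEq D] (f : Perm D) (a b : D)
    (h : ¬ SameCycle f a b) : SameCycle (f * swap a b) a b := by
  have key : ∀ n : ℕ, SameCycle (f * swap a b) a ((f ^ (n+1)) b) := by
    intro n
    induction n with
    | zero => exact ⟨1, by simp⟩
    | succ n ih =>
      have hya : (f ^ (n+1)) b ≠ a := by
        intro hh
        apply h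
        exact SameCycle.symm ⟨((n+1 : ℕ) : ℤ), by rw [zpow_natCast]; exact hh⟩
      rw [pow_succ', Perm.mul_apply]
      by_cases hyb : (f ^ (n+1)) b = b
      · rw [hyb]; exact ⟨1, by simp⟩
      · refine ih.trans ⟨1, ?_⟩
        rw [zpow_one, Perm.mul_apply, swap_apply_of_ne_of_ne hya hyb]
  have ho : 0 < orderOf f := orderOf_pos f
  have := key (orderOf f - 1)
  rwa [Nat.sub_add_cancel ho, pow_orderOf_eq_one] at this

theorem swap_split {D : Type*} [Finite D] [DecidableEq D] (f : Perm D) (a b : D) (hab : a ≠ b)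
    (h : SameCycle f a b) : ¬ SameCycle (f * swap a b) a b := by
  classical
  have hex : ∃ k : ℕ, 0 < k ∧ (f ^ k) b = a := by
    obtain ⟨k, hk, _, h2⟩ := h.symm.exists_pow_eq''
    exact ⟨k, hk, h2⟩
  let k := Nat.find hex
  obtain ⟨hk0, hk⟩ : 0 < k ∧ (f ^ k) b = a := Nat.find_spec hex
  have hmin : ∀ j, 0 < j → j < k → (f ^ j) b ≠ a := fun j hj hjk hh =>
    Nat.find_min hex hjk ⟨hj, hh⟩
  have hnb : ∀ j, 0 < j → j ≤ k → (f ^ j) b ≠ b := by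
    intro j hj hjk hh
    rcases hjk.lt_or_eq with h1 | h1
    · apply hmin (k - j) (by omega) (by omega)
      have : (f ^ (k - j + j)) b = a := by rw [Nat.sub_add_cancel hjk]; exact hk
      rw [pow_add, Perm.mul_apply, hh] at this
      exact this
    · rw [h1, hk] at hh; exact hab hh
  have inv : ∀ n : ℕ, ∃ j, 0 < j ∧ j ≤ k ∧ ((f * swap a b) ^ n) a = (f ^ j) b := by
    intro n
    induction n with
    | zero => exact ⟨k, hk0, le_rfl, hk.symm⟩
    | succ n ih =>
      obtain ⟨j, hj0, hjk, hj⟩ := ih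
      rw [pow_succ', Perm.mul_apply, hj]
      rcases hjk.lt_or_eq with h1 | h1
      · refine ⟨j+1, by omega, by omega, ?_⟩
        rw [Perm.mul_apply, swap_apply_of_ne_of_ne (hmin j hj0 h1) (hnb j hj0 hjk), pow_succ',
          Perm.mul_apply]
      · exact ⟨1, by omega, hk0, by rw [h1, hk]; simp⟩
  intro hs
  obtain ⟨n, _, hn⟩ := hs.exists_pow_eq'
  obtain ⟨j, hj0, hjk, hj⟩ := inv n
  exact hnb j hj0 hjk (hj.symm.trans hn)

theorem cyc_split {D : Type*} [Finite D] [DecidableEq D] (f : Perm D) (a b : D) (hab : a ≠ b)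
    (h : SameCycle f a b) : cycCount f + 1 ≤ cycCount (f * swap a b) := by
  refine quot_J2 _ _ a b ?_ h (swap_split f a b hab h)
  intro x y hxy
  refine sameCycle_of_step (f * swap a b) (fun x y => SameCycle f x y) (fun x => SameCycle.refl _ _)
    (fun x y z => SameCycle.trans) ?_ hxy
  intro x
  rw [Perm.mul_apply]
  by_cases hxa : x = a
  · subst hxa; rw [swap_apply_left]; exact h.trans ⟨1, by simp⟩
  by_cases hxb : x = b
  · subst hxb; rw [swap_apply_right]; exact h.symm.trans ⟨1, by simp⟩
  rw [swap_apply_of_ne_of_ne hxa hxb]; exact ⟨1, by simp⟩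

theorem cyc_merge {D : Type*} [Finite D] [DecidableEq D] (f : Perm D) (a b : D)
    (h : ¬ SameCycle f a b) : cycCount f ≤ cycCount (f * swap a b) + 1 := by
  have hm := swap_merge f a b h
  refine quot_J1 _ _ a b ?_ ?_
  · intro x y hxy
    refine sameCycle_of_step f (fun x y => SameCycle (f * swap a b) x y)
      (fun x => SameCycle.refl _ _) (fun x y z => SameCycle.trans) ?_ hxy
    intro x
    by_cases hxa : x = a
    · subst hxa; exact hm.trans ⟨1, by simp⟩
    by_cases hxb : x = b
    · subst hxb; exact hm.symm.trans ⟨1, by simp⟩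
    exact ⟨1, by rw [zpow_one, Perm.mul_apply, swap_apply_of_ne_of_ne hxa hxb]⟩
  · intro x y hxy
    refine sameCycle_of_step (f * swap a b) (fun x y => SameCycle f x y ∨
      ((SameCycle f x a ∨ SameCycle f x b) ∧ (SameCycle f y a ∨ SameCycle f y b)))
      (fun x => Or.inl (SameCycle.refl _ _)) ?_ ?_ hxy
    · intro x y z h1 h2
      rcases h1 with h1 | ⟨h1, h1'⟩
      · rcases h2 with h2 | ⟨h2, h2'⟩
        · exact Or.inl (h1.trans h2)
        · exact Or.inr ⟨h2.imp h1.trans h1.trans, h2'⟩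
      · rcases h2 with h2 | ⟨h2, h2'⟩
        · exact Or.inr ⟨h1, h1'.imp h2.symm.trans h2.symm.trans⟩
        · exact Or.inr ⟨h1, h2'⟩
    · intro x
      rw [Perm.mul_apply]
      by_cases hxa : x = a
      · subst hxa; rw [swap_apply_left]
        exact Or.inr ⟨Or.inl (SameCycle.refl _ _), Or.inr (SameCycle.symm ⟨1, by simp⟩)⟩
      by_cases hxb : x = b
      · subst hxb; rw [swap_apply_right]
        exact Or.inr ⟨Or.inr (SameCycle.refl _ _), Or.inl (SameCycle.symm ⟨1, by simp⟩)⟩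
      rw [swap_apply_of_ne_of_ne hxa hxb]; exact Or.inl ⟨1, by simp⟩

end Aux

section Aux2
open Equiv Equiv.Perm

/-- reversal restricted to the darts lying in `G` -/
noncomputable def revOn {V : Type*} (H G : SimpleGraph V) : Perm H.Dart := by
  classical
  exact Function.Involutive.toPerm (fun x => if G.Adj x.fst x.snd then x.symm else x) (by
    intro x
    by_cases h : G.Adj x.fst x.snd
    · have h' : G.Adj x.symm.fst x.symm.snd := h.symm
      simp only [h, if_true]
      rw [if_pos h', SimpleGraph.Dart.symm_symm]
    · simp only [h, if_false])

theorem revOn_pos {V : Type*} {H G : SimpleGraph V} {x : H.Dart} (h : G.Adj x.fst x.snd) :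
    revOn H G x = x.symm := by
  exact if_pos h

theorem revOn_neg {V : Type*} {H G : SimpleGraph V} {x : H.Dart} (h : ¬ G.Adj x.fst x.snd) :
    revOn H G x = x := by
  exact if_neg h

theorem comp_le {V : Type*} [Finite V] (G G' : SimpleGraph V) (u v : V)
    (hle : G ≤ G') (h : ∀ x y, G'.Adj x y → G.Adj x y ∨ (x = u ∧ y = v) ∨ (x = v ∧ y = u)) :
    Nat.card G.ConnectedComponent ≤ Nat.card G'.ConnectedComponent + 1 := by
  refine quot_J1 G.reachableSetoid G'.reachableSetoid u v (fun x y hxy => ?_) ?_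
  · exact SimpleGraph.Reachable.mono hle hxy
  · intro x y hxy
    obtain ⟨w⟩ : G'.Reachable x y := hxy
    change G.Reachable x y ∨ ((G.Reachable x u ∨ G.Reachable x v) ∧
      (G.Reachable y u ∨ G.Reachable y v))
    induction w with
    | nil => exact Or.inl (SimpleGraph.Reachable.refl _)
    | @cons x y z hxy w ih =>
      rcases h _ _ hxy with h1 | ⟨rfl, rfl⟩ | ⟨rfl, rfl⟩
      · have h1 := h1.reachable
        rcases ih with h2 | ⟨h2, h2'⟩
        · exact Or.inl (h1.trans h2)
        · exact Or.inr ⟨h2.imp h1.trans h1.trans, h2'⟩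
      · rcases ih with h2 | ⟨h2, h2'⟩
        · exact Or.inr ⟨Or.inl (SimpleGraph.Reachable.refl _), Or.inr h2.symm⟩
        · exact Or.inr ⟨Or.inl (SimpleGraph.Reachable.refl _), h2'⟩
      · rcases ih with h2 | ⟨h2, h2'⟩
        · exact Or.inr ⟨Or.inr (SimpleGraph.Reachable.refl _), Or.inl h2.symm⟩
        · exact Or.inr ⟨Or.inr (SimpleGraph.Reachable.refl _), h2'⟩

theorem comp_le' {V : Type*} [Finite V] (G G' : SimpleGraph V) (u v : V)
    (h : ∀ x y, G'.Adj x y → G.Adj x y ∨ (x = u ∧ y = v) ∨ (x = v ∧ y = u))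
    (huv : G.Reachable u v) :
    Nat.card G.ConnectedComponent ≤ Nat.card G'.ConnectedComponent := by
  have key : ∀ x y, G'.Reachable x y → G.Reachable x y := by
    intro x y ⟨w⟩
    induction w with
    | nil => exact SimpleGraph.Reachable.refl _
    | @cons x y z hxy w ih =>
      rcases h _ _ hxy with h1 | ⟨rfl, rfl⟩ | ⟨rfl, rfl⟩
      · exact h1.reachable.trans ih
      · exact huv.trans ih
      · exact huv.symm.trans ih
  refine Nat.card_le_card_of_surjective
    (Quot.map id key : G'.ConnectedComponent → G.ConnectedComponent) ?_
  intro q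
  refine Quot.inductionOn q (fun x => ⟨Quot.mk _ x, rfl⟩)

/-- Euler defect -/
noncomputable def defect {V : Type*} [Fintype V] {H : SimpleGraph V} (R : RotationSystem H)
    (G : SimpleGraph V) : ℤ :=
  (Nat.card G.edgeSet : ℤ) + 2 * Nat.card G.ConnectedComponent - Fintype.card V
    - cycCount (R.σ * revOn H G)

theorem defect_delete {V : Type*} [Fintype V] {H : SimpleGraph V} (R : RotationSystem H)
    (G : SimpleGraph V) (hG : G ≤ H) (u v : V) (huv : G.Adj u v) :
    defect R (G.deleteEdges {s(u,v)}) ≤ defect R G := by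
  classical
  set G2 := G.deleteEdges {s(u,v)} with hG2
  have hle : G2 ≤ G := SimpleGraph.deleteEdges_le _
  have hadj2 : ∀ x y, G2.Adj x y ↔ G.Adj x y ∧ s(x,y) ≠ s(u,v) := by
    intro x y; simp [hG2, SimpleGraph.deleteEdges_adj]
  have hadj : ∀ x y, G.Adj x y → G2.Adj x y ∨ (x = u ∧ y = v) ∨ (x = v ∧ y = u) := by
    intro x y hxy
    rw [hadj2]
    by_cases h : s(x,y) = s(u,v)
    · right; simpa using h
    · exact Or.inl ⟨hxy, h⟩
  have hE : Nat.card G.edgeSet = Nat.card G2.edgeSet + 1 := by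
    rw [Nat.card_coe_set_eq, Nat.card_coe_set_eq, hG2, SimpleGraph.edgeSet_deleteEdges]
    rw [Set.ncard_sdiff_singleton_add_one (s := G.edgeSet) (a := s(u,v)) huv (Set.toFinite _)]
  let d : H.Dart := ⟨(u,v), hG huv⟩
  have hne : d ≠ d.symm := fun h => huv.ne (congrArg (fun x : H.Dart => x.fst) h)
  have hrev : revOn H G2 = revOn H G * swap d d.symm := by
    ext1 x
    rw [Perm.mul_apply]
    by_cases h1 : x = d
    · subst h1
      rw [swap_apply_left, revOn_neg (by rw [hadj2]; simp [d]), revOn_pos (by exact huv.symm),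
        SimpleGraph.Dart.symm_symm]
    by_cases h2 : x = d.symm
    · subst h2
      rw [swap_apply_right, revOn_neg (by rw [hadj2]; simp [d, Sym2.eq_swap]), revOn_pos (by exact huv)]
    rw [swap_apply_of_ne_of_ne h1 h2]
    have hx : G2.Adj x.fst x.snd ↔ G.Adj x.fst x.snd := by
      rw [hadj2]
      refine and_iff_left ?_
      intro h
      rcases Sym2.eq_iff.mp h with ⟨h3, h4⟩ | ⟨h3, h4⟩
      · exact h1 (SimpleGraph.Dart.ext _ _ (Prod.ext h3 h4))
      · exact h2 (SimpleGraph.Dart.ext _ _ (Prod.ext h3 h4))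
    by_cases h : G.Adj x.fst x.snd
    · rw [revOn_pos h, revOn_pos (hx.2 h)]
    · rw [revOn_neg h, revOn_neg (fun h' => h (hx.1 h'))]
  unfold defect
  rw [hE]
  have hφ : R.σ * revOn H G2 = (R.σ * revOn H G) * swap d d.symm := by rw [hrev, mul_assoc]
  by_cases hs : SameCycle (R.σ * revOn H G) d d.symm
  · have h1 := cyc_split _ d d.symm hne hs
    rw [← hφ] at h1
    have h2 := comp_le G2 G u v hle hadj
    push_cast
    omega
  · have h1 := cyc_merge _ d d.symm hs
    have hm := swap_merge _ d d.symm hs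
    rw [← hφ] at h1 hm
    have hre : G2.Reachable u v := by
      refine sameCycle_of_step (R.σ * revOn H G2) (fun x y => G2.Reachable x.fst y.fst)
        (fun x => SimpleGraph.Reachable.refl _) (fun x y z => SimpleGraph.Reachable.trans) ?_ hm
      intro x
      rw [Perm.mul_apply, R.tail_fixed]
      by_cases h : G2.Adj x.fst x.snd
      · rw [revOn_pos h]; exact h.reachable
      · rw [revOn_neg h]
    have h2 := comp_le' G2 G u v hadj hre
    push_cast
    omega

theorem defect_mono {V : Type*} [Fintype V] {H : SimpleGraph V} (R : RotationSystem H)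
    (G1 : SimpleGraph V) : ∀ (n : ℕ) (G2 : SimpleGraph V), G1 ≤ G2 → G2 ≤ H →
      (G2.edgeSet \ G1.edgeSet).ncard = n → defect R G1 ≤ defect R G2 := by
  intro n
  induction n with
  | zero =>
    intro G2 h1 h2 h
    rw [Set.ncard_eq_zero (Set.toFinite _), Set.sdiff_eq_empty, SimpleGraph.edgeSet_subset_edgeSet] at h
    rw [le_antisymm h1 h]
  | succ n ih =>
    intro G2 h1 h2 h
    have hne : (G2.edgeSet \ G1.edgeSet).Nonempty := by
      rw [← Set.ncard_pos (Set.toFinite _)]; omega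
    obtain ⟨e, he, he1⟩ := hne
    induction e with | _ u v
    refine le_trans (ih (G2.deleteEdges {s(u,v)}) ?_ ?_ ?_) (defect_delete R G2 h2 u v he)
    · intro x y hxy
      rw [SimpleGraph.deleteEdges_adj]
      refine ⟨h1 hxy, fun hh => he1 ?_⟩
      rw [Set.mem_singleton_iff] at hh
      rw [← hh]; exact hxy
    · exact (SimpleGraph.deleteEdges_le _).trans h2
    · have := Set.ncard_sdiff_singleton_add_one (s := G2.edgeSet \ G1.edgeSet) (a := s(u,v))
        ⟨he, he1⟩ (Set.toFinite _)
      rw [SimpleGraph.edgeSet_deleteEdges, sdiff_right_comm]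
      omega

theorem defect_bot {V : Type*} [Fintype V] {H : SimpleGraph V} (R : RotationSystem H) :
    0 ≤ defect R ⊥ := by
  classical
  have h1 : Nat.card (⊥ : SimpleGraph V).ConnectedComponent = Fintype.card V := by
    rw [← Nat.card_eq_fintype_card]
    refine (Nat.card_eq_of_bijective (SimpleGraph.connectedComponentMk ⊥) ⟨?_, ?_⟩).symm
    · intro x y h
      exact SimpleGraph.reachable_bot.mp (SimpleGraph.ConnectedComponent.exact h)
    · intro q
      exact Quot.inductionOn q (fun x => ⟨x, rfl⟩)
  have h2 : cycCount (R.σ * revOn H ⊥) ≤ Fintype.card V := by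
    have : revOn H ⊥ = 1 := by
      ext1 x
      rw [revOn_neg (by simp)]; rfl
    rw [this, mul_one, ← Nat.card_eq_fintype_card]
    refine Nat.card_le_card_of_injective
      (Quotient.lift (s := SameCycle.setoid R.σ) (fun x : H.Dart => x.fst) ?_) ?_
    · intro x y h
      exact sameCycle_of_step R.σ (fun x y => x.fst = y.fst) (fun _ => rfl)
        (fun _ _ _ => Eq.trans) (fun x => (R.tail_fixed x).symm) h
    · intro q r
      refine Quotient.inductionOn₂ q r ?_
      intro x y h
      exact Quotient.sound (R.vertex_cycles x y h)
  unfold defect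
  rw [h1]
  omega

theorem defect_top {V : Type*} [Fintype V] {H : SimpleGraph V} (R : RotationSystem H)
    (hR : R.IsPlanarEmbedding) : defect R H = 0 := by
  have h1 : revOn H H = dartRev H := by
    ext1 x
    rw [revOn_pos x.adj]; rfl
  have h2 : cycCount (R.σ * revOn H H) = R.numFaces := by
    rw [h1]; rfl
  unfold defect
  rw [h2]
  unfold RotationSystem.IsPlanarEmbedding at hR
  omega

theorem defect_zero {V : Type*} [Fintype V] {H : SimpleGraph V} (R : RotationSystem H)
    (hR : R.IsPlanarEmbedding) (G : SimpleGraph V) (hG : G ≤ H) : defect R G = 0 := by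
  have h1 := defect_mono R G _ H hG le_rfl rfl
  have h2 := defect_mono R ⊥ _ G bot_le hG rfl
  have h3 := defect_bot R
  have h4 := defect_top R hR
  omega

end Aux2

section Aux3
open Equiv Equiv.Perm

theorem fr_exists {D : Type*} [Finite D] (f : Perm D) (p : D → Prop) (x : D) (hx : p x) :
    ∃ k : ℕ, 0 < k ∧ p ((f ^ k) x) :=
  ⟨orderOf f, orderOf_pos f, by rw [pow_orderOf_eq_one]; exact hx⟩

open Classical in
/-- return time -/
noncomputable def frTime {D : Type*} [Finite D] (f : Perm D) (p : D → Prop) (x : {x // p x}) : ℕ :=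
  Nat.find (fr_exists f p x.1 x.2)

theorem frTime_pos {D : Type*} [Finite D] (f : Perm D) (p : D → Prop) (x : {x // p x}) :
    0 < frTime f p x := by
  classical
  exact (Nat.find_spec (fr_exists f p x.1 x.2)).1

theorem frTime_mem {D : Type*} [Finite D] (f : Perm D) (p : D → Prop) (x : {x // p x}) :
    p ((f ^ frTime f p x) x.1) := by
  classical
  exact (Nat.find_spec (fr_exists f p x.1 x.2)).2

theorem frTime_le {D : Type*} [Finite D] (f : Perm D) (p : D → Prop) (x : {x // p x}) (k : ℕ)
    (hk : 0 < k) (h : p ((f ^ k) x.1)) : frTime f p x ≤ k := by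
  classical
  exact Nat.find_min' (fr_exists f p x.1 x.2) ⟨hk, h⟩

/-- first return map -/
noncomputable def frMap {D : Type*} [Finite D] (f : Perm D) (p : D → Prop) (x : {x // p x}) :
    {x // p x} := ⟨(f ^ frTime f p x) x.1, frTime_mem f p x⟩

theorem frMap_inj {D : Type*} [Finite D] (f : Perm D) (p : D → Prop) :
    Function.Injective (frMap f p) := by
  have key : ∀ x y : {x // p x}, frTime f p x ≤ frTime f p y → frMap f p x = frMap f p y →
      x = y := by
    intro x y hle h
    have h1 : (f ^ frTime f p x) x.1 = (f ^ frTime f p y) y.1 := congrArg Subtype.val h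
    rw [← Nat.add_sub_cancel' hle, pow_add, Perm.mul_apply] at h1
    have h2 := (f ^ frTime f p x).injective h1
    rcases Nat.eq_zero_or_pos (frTime f p y - frTime f p x) with h3 | h3
    · rw [h3] at h2; exact Subtype.ext h2
    · have := frTime_le f p y _ h3 (by rw [← h2]; exact x.2)
      have := frTime_pos f p x
      omega
  intro x y h
  rcases le_total (frTime f p x) (frTime f p y) with h1 | h1
  · exact key x y h1 h
  · exact (key y x h1 h.symm).symm

/-- first return permutation -/
noncomputable def frPerm {D : Type*} [Finite D] (f : Perm D) (p : D → Prop) : Perm {x // p x} :=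
  Equiv.ofBijective (frMap f p) (Finite.injective_iff_bijective.mp (frMap_inj f p))

theorem frPerm_sameCycle {D : Type*} [Finite D] (f : Perm D) (p : D → Prop) (x y : {x // p x}) :
    SameCycle (frPerm f p) x y ↔ SameCycle f x.1 y.1 := by
  constructor
  · intro h
    exact sameCycle_of_step (frPerm f p) (fun x y => SameCycle f x.1 y.1)
      (fun _ => SameCycle.refl _ _) (fun _ _ _ => SameCycle.trans)
      (fun x => ⟨(frTime f p x : ℤ), by rw [zpow_natCast]; rfl⟩) h
  · intro h
    obtain ⟨n, _, hn⟩ := h.exists_pow_eq'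
    clear h
    induction n using Nat.strong_induction_on generalizing x with
    | _ n ih =>
      rcases Nat.eq_zero_or_pos n with h0 | h0
      · subst h0
        rw [Subtype.ext (show x.1 = y.1 from hn)]
      · have hle := frTime_le f p x n h0 (by rw [hn]; exact y.2)
        have hpos := frTime_pos f p x
        have h1 : SameCycle (frPerm f p) (frPerm f p x) y := by
          apply ih (n - frTime f p x) (by omega) (frPerm f p x) (by omega)
          change (f ^ (n - frTime f p x)) ((f ^ frTime f p x) x.1) = y.1
          rw [← Perm.mul_apply, ← pow_add, Nat.sub_add_cancel hle, hn]
        exact SameCycle.trans ⟨1, by simp⟩ h1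

theorem planar_sub {V W : Type*} [Fintype V] [Fintype W] {H : SimpleGraph V}
    (R : RotationSystem H)
    (hR : R.IsPlanarEmbedding) (G : SimpleGraph V) (hG : G ≤ H)
    (hiso : ∀ v, ∃ w, G.Adj v w) (ε : W ≃ V) : IsPlanar (G.comap ε) := by
  classical
  let p : H.Dart → Prop := fun x => G.Adj x.fst x.snd
  let E : (G.comap ε).Dart ≃ {x : H.Dart // p x} :=
    { toFun := fun d => ⟨⟨(ε d.fst, ε d.snd), hG d.adj⟩, d.adj⟩
      invFun := fun x => ⟨(ε.symm x.1.fst, ε.symm x.1.snd), by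
        have := x.2
        simpa [p] using this⟩
      left_inv := fun d => by
        apply SimpleGraph.Dart.ext; simp
      right_inv := fun x => by
        apply Subtype.ext; apply SimpleGraph.Dart.ext; simp }
  have hEfst : ∀ d, (E d).1.fst = ε d.fst := fun d => rfl
  have hEsnd : ∀ d, (E d).1.snd = ε d.snd := fun d => rfl
  let σ' : Perm (G.comap ε).Dart := E.trans ((frPerm R.σ p).trans E.symm)
  have hσ' : ∀ d, E (σ' d) = frPerm R.σ p (E d) := fun d => by simp [σ']
  have transfer : ∀ (f : Perm {x : H.Dart // p x}) (g : Perm (G.comap ε).Dart)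
      (_ : ∀ d, E (g d) = f (E d)) (d d'), SameCycle g d d' ↔ SameCycle f (E d) (E d') := by
    intro f g hfg d d'
    have hg : g = E.symm.permCongr f := by
      ext1 x
      rw [Equiv.permCongr_apply, Equiv.symm_symm, ← hfg, Equiv.symm_apply_apply]
    constructor
    · intro h
      exact sameCycle_of_step g (fun d d' => SameCycle f (E d) (E d')) (fun _ => SameCycle.refl _ _)
        (fun _ _ _ => SameCycle.trans) (fun x => ⟨1, by rw [zpow_one, hfg]⟩) h
    · intro h
      have := sameCycle_of_step f (fun x y => SameCycle g (E.symm x) (E.symm y))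
        (fun _ => SameCycle.refl _ _)
        (fun _ _ _ => SameCycle.trans) (fun x => ⟨1, by
          apply E.injective
          rw [zpow_one, hfg]; simp⟩) h
      simpa using this
  have htail : ∀ n : ℕ, ∀ x : H.Dart, ((R.σ ^ n) x).fst = x.fst := by
    intro n x
    induction n with
    | zero => rfl
    | succ n ih => rw [pow_succ', Perm.mul_apply, R.tail_fixed, ih]
  let R' : RotationSystem (G.comap ε) :=
    { σ := σ'
      tail_fixed := by
        intro d
        apply ε.injective
        rw [← hEfst, ← hEfst, hσ']
        exact htail _ _
      vertex_cycles := by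
        intro d d' h
        rw [transfer _ _ hσ', frPerm_sameCycle]
        apply R.vertex_cycles
        rw [hEfst, hEfst, h] }
  refine ⟨R', ?_⟩
  let ψ : Perm H.Dart := R.σ * revOn H G
  have hφ : ∀ d, E (R'.φ d) = frPerm ψ p (E d) := by
    intro d
    have h1 : R'.φ d = σ' d.symm := rfl
    rw [h1, hσ']
    set x := E d with hx
    have hy : (E d.symm).1 = x.1.symm := rfl
    set y := E d.symm with hyy
    have hpow : ∀ j, 0 < j → j ≤ frTime R.σ p y → (ψ ^ j) x.1 = (R.σ ^ j) y.1 := by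
      intro j
      induction j with
      | zero => intro h; omega
      | succ j ih =>
        intro _ hj
        rw [pow_succ', Perm.mul_apply, pow_succ' R.σ, Perm.mul_apply R.σ (R.σ ^ j)]
        rcases Nat.eq_zero_or_pos j with h0 | h0
        · subst h0
          change R.σ (revOn H G x.1) = R.σ y.1
          rw [revOn_pos x.2, hy]
        · rw [ih h0 (by omega)]
          change R.σ (revOn H G _) = _
          rw [revOn_neg]
          intro hp
          have := frTime_le R.σ p y j h0 hp
          omega
    have ht : frTime ψ p x = frTime R.σ p y := by
      apply le_antisymm
      · apply frTime_le _ _ _ _ (frTime_pos _ _ _)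
        rw [hpow _ (frTime_pos _ _ _) le_rfl]
        exact frTime_mem _ _ _
      · by_contra hlt
        push Not at hlt
        have h2 := frTime_mem ψ p x
        rw [hpow _ (frTime_pos _ _ _) hlt.le] at h2
        have := frTime_le R.σ p y _ (frTime_pos _ _ _) h2
        omega
    apply Subtype.ext
    change (R.σ ^ frTime R.σ p y) y.1 = (ψ ^ frTime ψ p x) x.1
    rw [ht, hpow _ (frTime_pos _ _ _) le_rfl]
  have hmeet : ∀ y : H.Dart, ∃ x : {x // p x}, SameCycle ψ x.1 y := by
    intro y
    by_contra hno
    push Not at hno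
    have h1 : ∀ j : ℕ, (ψ ^ j) y = (R.σ ^ j) y := by
      intro j
      induction j with
      | zero => rfl
      | succ j ih =>
        rw [pow_succ', Perm.mul_apply, pow_succ' R.σ, Perm.mul_apply R.σ (R.σ ^ j), ← ih]
        change R.σ (revOn H G _) = _
        rw [revOn_neg]
        intro hp
        exact hno ⟨_, hp⟩ (SameCycle.symm ⟨(j : ℤ), by rw [zpow_natCast]⟩)
    obtain ⟨w, hw⟩ := hiso y.fst
    obtain ⟨n, _, hn⟩ := (R.vertex_cycles y ⟨(y.fst, w), hG hw⟩ rfl).exists_pow_eq'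
    exact hno ⟨⟨(y.fst, w), hG hw⟩, hw⟩ (SameCycle.symm ⟨(n : ℤ), by
      rw [zpow_natCast, h1]; exact hn⟩)
  have hF : R'.numFaces = cycCount ψ := by
    refine Nat.card_eq_of_bijective
      (Quotient.map' (s₁ := R'.faceSetoid) (s₂ := SameCycle.setoid ψ) (fun d => (E d).1) ?_) ⟨?_, ?_⟩
    · intro d d' h
      exact (frPerm_sameCycle ψ p _ _).1 ((transfer _ _ hφ d d').1 h)
    · intro q r
      refine Quotient.inductionOn₂ q r ?_
      intro d d' h
      apply Quotient.sound
      exact (transfer _ _ hφ d d').2 ((frPerm_sameCycle ψ p _ _).2 (Quotient.exact h))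
    · intro q
      refine Quotient.inductionOn q ?_
      intro y
      obtain ⟨x, hx⟩ := hmeet y
      refine ⟨Quotient.mk R'.faceSetoid (E.symm x), ?_⟩
      apply Quotient.sound
      change SameCycle ψ (E (E.symm x)).1 y
      rw [Equiv.apply_symm_apply]; exact hx
  have hd := defect_zero R hR G hG
  unfold defect at hd
  have hE : Nat.card (G.comap ε).edgeSet = Nat.card G.edgeSet :=
    Nat.card_congr (SimpleGraph.Iso.comap ε G).mapEdgeSet
  have hC : Nat.card (G.comap ε).ConnectedComponent = Nat.card G.ConnectedComponent :=
    Nat.card_congr (SimpleGraph.Iso.comap ε G).connectedComponentEquiv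
  have hV : Fintype.card W = Fintype.card V := Fintype.card_congr ε
  unfold RotationSystem.IsPlanarEmbedding
  rw [hF, hE, hC, hV]
  change (_ : ℤ) - ((cycCount ψ : ℕ) : ℤ) = 0 at hd
  omega

end Aux3

section Aux4

theorem no_isolated {V : Type*} [Fintype V] {H : SimpleGraph V} (R : RotationSystem H)
    (hR : R.IsPlanarEmbedding) : ∀ v, ∃ w, H.Adj v w := by
  classical
  have h0 := defect_zero R hR ⊥ bot_le
  have h1 : Nat.card (⊥ : SimpleGraph V).ConnectedComponent = Fintype.card V := by
    rw [← Nat.card_eq_fintype_card]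
    refine (Nat.card_eq_of_bijective (SimpleGraph.connectedComponentMk ⊥) ⟨?_, ?_⟩).symm
    · intro x y h
      exact SimpleGraph.reachable_bot.mp (SimpleGraph.ConnectedComponent.exact h)
    · intro q
      exact Quot.inductionOn q (fun x => ⟨x, rfl⟩)
  have h3 : revOn H ⊥ = 1 := by
    ext1 x
    rw [revOn_neg (by simp)]; rfl
  unfold defect at h0
  rw [h1, h3, mul_one] at h0
  have h4 : Nat.card (⊥ : SimpleGraph V).edgeSet = 0 := by simp
  rw [h4] at h0
  have h5 : cycCount R.σ = Nat.card V := by rw [Nat.card_eq_fintype_card]; omega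
  let F : Quotient (Equiv.Perm.SameCycle.setoid R.σ) → V :=
    Quotient.lift (fun x : H.Dart => x.fst) (by
      intro x y h
      exact sameCycle_of_step R.σ (fun x y => x.fst = y.fst) (fun _ => rfl)
        (fun _ _ _ => Eq.trans) (fun x => (R.tail_fixed x).symm) h)
  have hF : Function.Injective F := by
    intro q r
    refine Quotient.inductionOn₂ q r ?_
    intro x y h
    exact Quotient.sound (R.vertex_cycles x y h)
  have hb : Function.Bijective F :=
    (Nat.bijective_iff_injective_and_card F).2 ⟨hF, h5⟩
  intro v
  obtain ⟨q, hq⟩ := hb.2 v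
  revert hq
  refine Quotient.inductionOn q ?_
  intro x hx
  have hx : x.fst = v := hx
  exact ⟨x.snd, hx ▸ x.adj⟩

theorem c4_help {C : Type*} (x a2 b2 a3 b3 a4 b4 : C)
    (h2 : a2 ≠ b2) (h3 : a3 ≠ b3) (h4 : a4 ≠ b4) (hx : x ≠ a2 ∧ x ≠ b2) :
    ∃ y2 y3 y4, (y2 = a2 ∨ y2 = b2) ∧ (y3 = a3 ∨ y3 = b3) ∧ (y4 = a4 ∨ y4 = b4) ∧
      x ≠ y2 ∧ y2 ≠ y3 ∧ y3 ≠ y4 ∧ y4 ≠ x := by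
  have pick : ∀ z a b : C, a ≠ b → ∃ y, (y = a ∨ y = b) ∧ y ≠ z := by
    intro z a b hab
    by_cases h : a = z
    · exact ⟨b, Or.inr rfl, fun h' => hab (h.trans h'.symm)⟩
    · exact ⟨a, Or.inl rfl, h⟩
  obtain ⟨y4, h4a, h4b⟩ := pick x a4 b4 h4
  obtain ⟨y3, h3a, h3b⟩ := pick y4 a3 b3 h3
  obtain ⟨y2, h2a, h2b⟩ := pick y3 a2 b2 h2
  refine ⟨y2, y3, y4, h2a, h3a, h4a, ?_, h2b, h3b, h4b⟩
  rcases h2a with rfl | rfl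
  · exact hx.1
  · exact hx.2

theorem c4_pairs {C : Type*} (a1 b1 a2 b2 a3 b3 a4 b4 : C) (h1 : a1 ≠ b1)
    (h2 : a2 ≠ b2) (h3 : a3 ≠ b3) (h4 : a4 ≠ b4) :
    ∃ y1 y2 y3 y4, (y1 = a1 ∨ y1 = b1) ∧ (y2 = a2 ∨ y2 = b2) ∧ (y3 = a3 ∨ y3 = b3) ∧
      (y4 = a4 ∨ y4 = b4) ∧ y1 ≠ y2 ∧ y2 ≠ y3 ∧ y3 ≠ y4 ∧ y4 ≠ y1 := by
  by_cases e1 : ∃ x, (x = a1 ∨ x = b1) ∧ x ≠ a2 ∧ x ≠ b2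
  · obtain ⟨x, hx, hx'⟩ := e1
    obtain ⟨y2, y3, y4, g⟩ := c4_help x a2 b2 a3 b3 a4 b4 h2 h3 h4 hx'
    exact ⟨x, y2, y3, y4, by tauto⟩
  by_cases e2 : ∃ x, (x = a2 ∨ x = b2) ∧ x ≠ a3 ∧ x ≠ b3
  · obtain ⟨x, hx, hx'⟩ := e2
    obtain ⟨y2, y3, y4, g⟩ := c4_help x a3 b3 a4 b4 a1 b1 h3 h4 h1 hx'
    exact ⟨y4, x, y2, y3, by tauto⟩
  by_cases e3 : ∃ x, (x = a3 ∨ x = b3) ∧ x ≠ a4 ∧ x ≠ b4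
  · obtain ⟨x, hx, hx'⟩ := e3
    obtain ⟨y2, y3, y4, g⟩ := c4_help x a4 b4 a1 b1 a2 b2 h4 h1 h2 hx'
    exact ⟨y3, y4, x, y2, by tauto⟩
  push Not at e1 e2 e3
  have f1 := or_iff_not_imp_left.2 (e1 a1 (Or.inl rfl))
  have f1' := or_iff_not_imp_left.2 (e1 b1 (Or.inr rfl))
  have f2 := or_iff_not_imp_left.2 (e2 a2 (Or.inl rfl))
  have f2' := or_iff_not_imp_left.2 (e2 b2 (Or.inr rfl))
  have f3 := or_iff_not_imp_left.2 (e3 a3 (Or.inl rfl))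
  have f3' := or_iff_not_imp_left.2 (e3 b3 (Or.inr rfl))
  clear e1 e2 e3
  refine ⟨a1, b1, a1, b1, Or.inl rfl, ?_, ?_, ?_, h1, h1.symm, h1, h1.symm⟩ <;> grind

theorem c4_choose {C : Type*} (L1 L2 L3 L4 : Finset C) (h1 : 1 < L1.card) (h2 : 1 < L2.card)
    (h3 : 1 < L3.card) (h4 : 1 < L4.card) : ∃ y1 ∈ L1, ∃ y2 ∈ L2, ∃ y3 ∈ L3, ∃ y4 ∈ L4,
      y1 ≠ y2 ∧ y2 ≠ y3 ∧ y3 ≠ y4 ∧ y4 ≠ y1 := by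
  obtain ⟨a1, p1, b1, q1, n1⟩ := Finset.one_lt_card.1 h1
  obtain ⟨a2, p2, b2, q2, n2⟩ := Finset.one_lt_card.1 h2
  obtain ⟨a3, p3, b3, q3, n3⟩ := Finset.one_lt_card.1 h3
  obtain ⟨a4, p4, b4, q4, n4⟩ := Finset.one_lt_card.1 h4
  obtain ⟨y1, y2, y3, y4, g1, g2, g3, g4, g⟩ := c4_pairs a1 b1 a2 b2 a3 b3 a4 b4 n1 n2 n3 n4
  refine ⟨y1, ?_, y2, ?_, y3, ?_, y4, ?_, g⟩
  · rcases g1 with rfl | rfl <;> assumption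
  · rcases g2 with rfl | rfl <;> assumption
  · rcases g3 with rfl | rfl <;> assumption
  · rcases g4 with rfl | rfl <;> assumption

/-- delete the four edges of a 4-cycle -/
def del4 {V : Type*} (H : SimpleGraph V) (a b c d : V) : SimpleGraph V :=
  H.deleteEdges {s(a,b), s(b,c), s(c,d), s(d,a)}

theorem del4_rot {V : Type*} (H : SimpleGraph V) (a b c d : V) :
    del4 H a b c d = del4 H b c d a := by
  unfold del4
  congr 1
  ext e
  simp only [Set.mem_insert_iff, Set.mem_singleton_iff]
  tauto

theorem del4_nbr {V : Type*} (H : SimpleGraph V) (a b c d : V) (hab : H.Adj a b)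
    (hda : H.Adj d a) (hac : a ≠ c) :
    (del4 H a b c d).neighborSet a = (H.neighborSet a) \ {b, d} := by
  ext w
  have h1 := hab.ne
  have h2 := hda.ne
  simp only [del4, SimpleGraph.mem_neighborSet, SimpleGraph.deleteEdges_adj, Set.mem_insert_iff,
    Set.mem_singleton_iff, Set.mem_sdiff, Sym2.eq_iff]
  grind

theorem del4_vdeg {V : Type*} [Finite V] (H : SimpleGraph V) (a b c d : V) (hab : H.Adj a b)
    (hda : H.Adj d a) (hac : a ≠ c) (hbd : b ≠ d) :
    vdeg (del4 H a b c d) a + 2 = vdeg H a := by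
  unfold vdeg
  rw [del4_nbr H a b c d hab hda hac, Nat.card_coe_set_eq, Nat.card_coe_set_eq]
  have h1 : ({b, d} : Set V) ⊆ H.neighborSet a := by
    intro x hx
    rcases hx with rfl | rfl
    · exact hab
    · exact hda.symm
  have h2 := Set.ncard_sdiff_add_ncard_of_subset h1 (Set.toFinite _)
  rw [Set.ncard_pair hbd] at h2
  exact h2

theorem del4_adj_of {V : Type*} (H : SimpleGraph V) (a b c d : V) {u v : V} (h : H.Adj u v)
    (hu : u ≠ a) (hu' : u ≠ c) (hv : v ≠ a) (hv' : v ≠ c) : (del4 H a b c d).Adj u v := by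
  simp only [del4, SimpleGraph.deleteEdges_adj, Set.mem_insert_iff, Set.mem_singleton_iff,
    Sym2.eq_iff]
  grind

theorem exists_avoid {V : Type*} [Finite V] (H : SimpleGraph V) (a : V) (h : vdeg H a = 3)
    (f g : V → Fin 7) : ∃ x : Fin 7, ∀ w, H.Adj a w → x ≠ f w ∧ x ≠ g w := by
  classical
  have := Fintype.ofFinite V
  have hc : (H.neighborFinset a).card = 3 := by
    rw [← h, vdeg, Nat.card_eq_fintype_card, SimpleGraph.card_neighborSet_eq_degree]; rfl
  let S := (H.neighborFinset a).image f ∪ (H.neighborFinset a).image g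
  have hS : S.card ≤ 6 := by
    refine (Finset.card_union_le _ _).trans ?_
    have h1 := Finset.card_image_le (s := H.neighborFinset a) (f := f)
    have h2 := Finset.card_image_le (s := H.neighborFinset a) (f := g)
    omega
  obtain ⟨x, hx⟩ : ∃ x, x ∉ S := by
    by_contra hno
    push Not at hno
    have : S = Finset.univ := Finset.eq_univ_of_forall hno
    rw [this] at hS
    simp at hS
  refine ⟨x, fun w hw => ⟨?_, ?_⟩⟩
  · rintro rfl
    exact hx (Finset.mem_union_left _ (Finset.mem_image_of_mem _ (by simpa using hw)))
  · rintro rfl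
    exact hx (Finset.mem_union_right _ (Finset.mem_image_of_mem _ (by simpa using hw)))

theorem exists_list {V : Type*} [Finite V] (G : SimpleGraph V) (a b : V) (ha : vdeg G a = 1)
    (hb : vdeg G b = 3) (ce : Sym2 V → Fin 7) (z : Fin 7) :
    ∃ L : Finset (Fin 7), 1 < L.card ∧ ∀ x ∈ L, x ≠ z ∧ (∀ w, G.Adj a w → x ≠ ce s(a,w)) ∧
      (∀ w, G.Adj b w → x ≠ ce s(b,w)) := by
  classical
  have := Fintype.ofFinite V
  have hca : (G.neighborFinset a).card = 1 := by
    rw [← ha, vdeg, Nat.card_eq_fintype_card, SimpleGraph.card_neighborSet_eq_degree]; rfl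
  have hcb : (G.neighborFinset b).card = 3 := by
    rw [← hb, vdeg, Nat.card_eq_fintype_card, SimpleGraph.card_neighborSet_eq_degree]; rfl
  let S := insert z ((G.neighborFinset a).image (fun w => ce s(a,w)) ∪
    (G.neighborFinset b).image (fun w => ce s(b,w)))
  have hS : S.card ≤ 5 := by
    refine (Finset.card_insert_le _ _).trans ?_
    have h0 := Finset.card_union_le ((G.neighborFinset a).image (fun w => ce s(a,w)))
      ((G.neighborFinset b).image (fun w => ce s(b,w)))
    have h1 := Finset.card_image_le (s := G.neighborFinset a) (f := (fun w => ce s(a,w)))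
    have h2 := Finset.card_image_le (s := G.neighborFinset b) (f := (fun w => ce s(b,w)))
    omega
  refine ⟨Sᶜ, ?_, ?_⟩
  · rw [Finset.card_compl, Fintype.card_fin]; omega
  · intro x hx
    rw [Finset.mem_compl] at hx
    refine ⟨?_, ?_, ?_⟩
    · rintro rfl; exact hx (Finset.mem_insert_self _ _)
    · rintro w hw rfl
      exact hx (Finset.mem_insert_of_mem (Finset.mem_union_left _
        (Finset.mem_image.2 ⟨w, by simpa using hw, rfl⟩)))
    · rintro w hw rfl
      exact hx (Finset.mem_insert_of_mem (Finset.mem_union_right _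
        (Finset.mem_image.2 ⟨w, by simpa using hw, rfl⟩)))

theorem extend_coloring {V : Type*} [Finite V] (H : SimpleGraph V) (a b c d : V)
    (hab : H.Adj a b) (hbc : H.Adj b c) (hcd : H.Adj c d) (hda : H.Adj d a)
    (hac : a ≠ c) (hbd : b ≠ d) (ha : vdeg H a = 3) (hb : vdeg H b = 5) (hc : vdeg H c = 3)
    (hd : vdeg H d = 5) (hcol : TotallyColorable (del4 H a b c d) 7) : TotallyColorable H 7 := by
  classical
  obtain ⟨cv, ce, hvv, hee, hev⟩ := hcol
  set G := del4 H a b c d with hG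
  have da0 : vdeg G a + 2 = vdeg H a := del4_vdeg H a b c d hab hda hac hbd
  have dc0 : vdeg G c + 2 = vdeg H c := by
    have := del4_vdeg H c d a b hcd hbc hac.symm hbd.symm
    rwa [← del4_rot, ← del4_rot] at this
  have db0 : vdeg G b + 2 = vdeg H b := by
    have := del4_vdeg H b c d a hbc hab hbd hac.symm
    rwa [← del4_rot] at this
  have dd0 : vdeg G d + 2 = vdeg H d := by
    have := del4_vdeg H d a b c hda hcd hbd.symm hac
    rwa [← del4_rot, ← del4_rot, ← del4_rot] at this
  have da : vdeg G a = 1 := by omega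
  have db : vdeg G b = 3 := by omega
  have dc : vdeg G c = 1 := by omega
  have dd : vdeg G d = 3 := by omega
  obtain ⟨L1, c1, l1⟩ := exists_list G a b da db ce (cv b)
  obtain ⟨L2, c2, l2⟩ := exists_list G c b dc db ce (cv b)
  obtain ⟨L3, c3, l3⟩ := exists_list G c d dc dd ce (cv d)
  obtain ⟨L4, c4, l4⟩ := exists_list G a d da dd ce (cv d)
  obtain ⟨x1, m1, x2, m2, x3, m3, x4, m4, n12, n23, n34, n41⟩ := c4_choose L1 L2 L3 L4 c1 c2 c3 c4
  replace l1 := l1 x1 m1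
  replace l2 := l2 x2 m2
  replace l3 := l3 x3 m3
  replace l4 := l4 x4 m4
  have nab := hab.ne
  have nbc := hbc.ne
  have ncd := hcd.ne
  have nda := hda.ne
  let ce' : Sym2 V → Fin 7 := fun e => if e = s(a,b) then x1 else if e = s(b,c) then x2 else
    if e = s(c,d) then x3 else if e = s(d,a) then x4 else ce e
  have e1 : ce' s(a,b) = x1 := by simp [ce']
  have e2 : ce' s(b,c) = x2 := by
    simp only [ce', Sym2.eq_iff]; grind
  have e3 : ce' s(c,d) = x3 := by
    simp only [ce', Sym2.eq_iff]; grind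
  have e4 : ce' s(d,a) = x4 := by
    simp only [ce', Sym2.eq_iff]; grind
  have hGadj : ∀ u v, G.Adj u v ↔ H.Adj u v ∧ s(u,v) ≠ s(a,b) ∧ s(u,v) ≠ s(b,c) ∧
      s(u,v) ≠ s(c,d) ∧ s(u,v) ≠ s(d,a) := by
    intro u v
    simp only [hG, del4, SimpleGraph.deleteEdges_adj, Set.mem_insert_iff, Set.mem_singleton_iff]
    tauto
  have e0 : ∀ u v, G.Adj u v → ce' s(u,v) = ce s(u,v) := by
    intro u v h
    rw [hGadj] at h
    obtain ⟨_, h1, h2, h3, h4⟩ := h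
    simp only [ce', h1, h2, h3, h4, if_false]
  have hcase : ∀ u v, H.Adj u v → G.Adj u v ∨ (u = a ∧ v = b ∨ u = b ∧ v = a) ∨
      (u = b ∧ v = c ∨ u = c ∧ v = b) ∨ (u = c ∧ v = d ∨ u = d ∧ v = c) ∨
      (u = d ∧ v = a ∨ u = a ∧ v = d) := by
    intro u v h
    rw [hGadj]
    simp only [← Sym2.eq_iff, h, true_and]
    tauto
  have e1' : ce' s(b,a) = x1 := by rw [Sym2.eq_swap]; exact e1
  have e2' : ce' s(c,b) = x2 := by rw [Sym2.eq_swap]; exact e2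
  have e3' : ce' s(d,c) = x3 := by rw [Sym2.eq_swap]; exact e3
  have e4' : ce' s(a,d) = x4 := by rw [Sym2.eq_swap]; exact e4
  clear_value ce'
  have hGG : ∀ v w w', G.Adj v w → G.Adj v w' → w ≠ w' → ce s(v,w) ≠ ce s(v,w') := by
    intro v w w' h h' hne
    apply hee _ h _ h'
    · intro hh
      rcases Sym2.eq_iff.1 hh with ⟨_, h2⟩ | ⟨h2, h3⟩
      · exact hne h2
      · exact h.ne h3.symm
    · exact ⟨v, Sym2.mem_mk_left _ _, Sym2.mem_mk_left _ _⟩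
  -- color of a removed edge differs from a kept edge
  have hmix : ∀ v w w', G.Adj v w → H.Adj v w' → ¬ G.Adj v w' → ce' s(v,w) ≠ ce' s(v,w') := by
    intro v w w' h h' hn
    rw [e0 _ _ h]
    rcases (hcase v w' h').resolve_left hn with (⟨rfl, rfl⟩ | ⟨rfl, rfl⟩) | (⟨rfl, rfl⟩ | ⟨rfl, rfl⟩) |
      (⟨rfl, rfl⟩ | ⟨rfl, rfl⟩) | (⟨rfl, rfl⟩ | ⟨rfl, rfl⟩)
    · rw [e1]; exact (l1.2.1 w h).symm
    · rw [e1']; exact (l1.2.2 w h).symm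
    · rw [e2]; exact (l2.2.2 w h).symm
    · rw [e2']; exact (l2.2.1 w h).symm
    · rw [e3]; exact (l3.2.1 w h).symm
    · rw [e3']; exact (l3.2.2 w h).symm
    · rw [e4]; exact (l4.2.2 w h).symm
    · rw [e4']; exact (l4.2.1 w h).symm
  have hedge : ∀ v w w', H.Adj v w → H.Adj v w' → w ≠ w' → ce' s(v,w) ≠ ce' s(v,w') := by
    intro v w w' h h' hne
    by_cases g : G.Adj v w
    · by_cases g' : G.Adj v w'
      · rw [e0 _ _ g, e0 _ _ g']; exact hGG v w w' g g' hne
      · exact hmix v w w' g h' g'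
    · by_cases g' : G.Adj v w'
      · exact (hmix v w' w g' h g).symm
      · have k := (hcase v w h).resolve_left g
        have k' := (hcase v w' h').resolve_left g'
        clear hcase hmix hGG e0 hGadj l1 l2 l3 l4 hee hev hvv
        grind
  obtain ⟨ca, hca⟩ := exists_avoid H a ha cv (fun w => ce' s(a,w))
  obtain ⟨cc, hcc⟩ := exists_avoid H c hc (Function.update cv a ca) (fun w => ce' s(c,w))
  let cv1 := Function.update cv a ca
  let cv2 := Function.update cv1 c cc
  have v2c : cv2 c = cc := by simp [cv2]
  have v2n : ∀ w, w ≠ c → cv2 w = cv1 w := fun w hw => by simp [cv2, hw]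
  have v1a : cv1 a = ca := by simp [cv1]
  have v1n : ∀ w, w ≠ a → cv1 w = cv w := fun w hw => by simp [cv1, hw]
  have hcc' : ∀ w, H.Adj c w → cv2 c ≠ cv2 w := by
    intro w hw
    rw [v2c, v2n w hw.ne']
    exact (hcc w hw).1
  have hca' : ∀ w, H.Adj a w → cv2 a ≠ cv2 w := by
    intro w hw
    by_cases h : w = c
    · subst h; exact (hcc' a hw.symm).symm
    · rw [v2n a hac, v2n w h, v1a, v1n w hw.ne']
      exact (hca w hw).1
  refine ⟨cv2, ce', ?_, ?_, ?_⟩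
  · intro u v h
    by_cases h1 : u = c
    · subst h1; exact hcc' v h
    by_cases h2 : u = a
    · subst h2; exact hca' v h
    by_cases h3 : v = c
    · subst h3; exact (hcc' u h.symm).symm
    by_cases h4 : v = a
    · subst h4; exact (hca' u h.symm).symm
    rw [v2n u h1, v2n v h3, v1n u h2, v1n v h4]
    exact hvv (del4_adj_of H a b c d h h2 h1 h4 h3)
  · rintro f1 h1 f2 h2 hne ⟨x, hx1, hx2⟩
    obtain ⟨w1, rfl⟩ := Sym2.mem_iff_exists.1 hx1
    obtain ⟨w2, rfl⟩ := Sym2.mem_iff_exists.1 hx2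
    exact hedge x w1 w2 h1 h2 (fun h => hne (by rw [h]))
  · intro u v h
    by_cases h1 : u = c
    · subst h1; rw [v2c]; exact ((hcc v h).2).symm
    by_cases h2 : u = a
    · subst h2; rw [v2n _ h1, v1a]; exact ((hca v h).2).symm
    rw [v2n _ h1, v1n _ h2]
    rcases hcase u v h with h0 | (⟨rfl, rfl⟩ | ⟨rfl, rfl⟩) | (⟨rfl, rfl⟩ | ⟨rfl, rfl⟩) |
      (⟨rfl, rfl⟩ | ⟨rfl, rfl⟩) | (⟨rfl, rfl⟩ | ⟨rfl, rfl⟩)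
    · rw [e0 _ _ h0]; exact hev h0
    · exact absurd rfl h2
    · rw [e1']; exact l1.1
    · rw [e2]; exact l2.1
    · exact absurd rfl h1
    · exact absurd rfl h1
    · rw [e3']; exact l3.1
    · rw [e4]; exact l4.1
    · exact absurd rfl h2

theorem vdeg_le {V : Type*} [Finite V] {G H : SimpleGraph V} (h : G ≤ H) (v : V) :
    vdeg G v ≤ vdeg H v := by
  unfold vdeg
  exact Nat.card_mono (Set.toFinite _) (fun w hw => h hw)

theorem vdeg_comap {V W : Type*} (G : SimpleGraph V) (ε : W ≃ V) (w : W) :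
    vdeg (G.comap ε) w = vdeg G (ε w) := by
  unfold vdeg
  exact Nat.card_congr ((SimpleGraph.Iso.comap ε G).mapNeighborSet w)

theorem edges_map_set {V W : Type*} {G : SimpleGraph W} {H : SimpleGraph V} (f : G →g H)
    {x y : W} (p : G.Walk x y) :
    {e | e ∈ (p.map f).edges} = Sym2.map f '' {e | e ∈ p.edges} := by
  ext e
  simp [SimpleGraph.Walk.edges_map]

theorem two4_map {V W : Type*} {G : SimpleGraph W} {H : SimpleGraph V} (f : G →g H)
    (hf : Function.Injective f) (v : W) (h : TwoAdjacentFourCyclesAt G v) :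
    TwoAdjacentFourCyclesAt H (f v) := by
  obtain ⟨c1, c2, h1, h2, h3, h4, h5, e, h6, h7⟩ := h
  refine ⟨c1.map f, c2.map f, h1.map hf, h2.map hf, by simpa using h3, by simpa using h4, ?_,
    Sym2.map f e, ?_, ?_⟩
  · rw [edges_map_set, edges_map_set]
    exact fun h => h5 ((Sym2.map.injective hf).image_injective h)
  · rw [SimpleGraph.Walk.edges_map]; exact List.mem_map_of_mem h6
  · rw [SimpleGraph.Walk.edges_map]; exact List.mem_map_of_mem h7

theorem three_map {V W : Type*} {G : SimpleGraph W} {H : SimpleGraph V} (f : G →g H)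
    (hf : Function.Injective f) (v : W) (p q l : ℕ) (h : ThreeCyclesAt G v p q l) :
    ThreeCyclesAt H (f v) p q l := by
  obtain ⟨c1, c2, c3, h1, h2, h3, l1, l2, l3, n1, n2, n3⟩ := h
  refine ⟨c1.map f, c2.map f, c3.map f, h1.map hf, h2.map hf, h3.map hf, by simpa using l1,
    by simpa using l2, by simpa using l3, ?_, ?_, ?_⟩
  · rw [edges_map_set, edges_map_set]
    exact fun h => n1 ((Sym2.map.injective hf).image_injective h)
  · rw [edges_map_set, edges_map_set]
    exact fun h => n2 ((Sym2.map.injective hf).image_injective h)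
  · rw [edges_map_set, edges_map_set]
    exact fun h => n3 ((Sym2.map.injective hf).image_injective h)

theorem main_core {V : Type*} [Fintype V] (H : SimpleGraph V)
    (hmin : MinimalCounterexample H)
    (R : RotationSystem H) (hR : R.IsPlanarEmbedding) (a b c d : V)
    (hab : H.Adj a b) (hbc : H.Adj b c) (hcd : H.Adj c d) (hda : H.Adj d a)
    (hac : a ≠ c) (hbd : b ≠ d) (ha : vdeg H a = 3) (hb : vdeg H b = 5) (hc : vdeg H c = 3)
    (hd : vdeg H d = 5) : False := by
  classical
  obtain ⟨⟨_, ⟨hmax, x, hx⟩, hdia, hhouse, hgood⟩, hnot, hm⟩ := hmin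
  set G := del4 H a b c d with hG
  have hle : G ≤ H := SimpleGraph.deleteEdges_le _
  have da : vdeg G a + 2 = vdeg H a := del4_vdeg H a b c d hab hda hac hbd
  have dc : vdeg G c + 2 = vdeg H c := by
    have := del4_vdeg H c d a b hcd hbc hac.symm hbd.symm
    rwa [← del4_rot, ← del4_rot] at this
  have db : vdeg G b + 2 = vdeg H b := by
    have := del4_vdeg H b c d a hbc hab hbd hac.symm
    rwa [← del4_rot] at this
  have dd : vdeg G d + 2 = vdeg H d := by
    have := del4_vdeg H d a b c hda hcd hbd.symm hac
    rwa [← del4_rot, ← del4_rot, ← del4_rot] at this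
  have hpos : ∀ v, 0 < vdeg G v → ∃ w, G.Adj v w := by
    intro v hv
    obtain ⟨⟨w, hw⟩⟩ := (Nat.card_pos_iff.1 hv).1
    exact ⟨w, hw⟩
  have hsame : ∀ v, v ≠ a → v ≠ b → v ≠ c → v ≠ d → ∀ w, H.Adj v w → G.Adj v w := by
    intro v h1 h2 h3 h4 w hw
    simp only [hG, del4, SimpleGraph.deleteEdges_adj, Set.mem_insert_iff, Set.mem_singleton_iff,
      Sym2.eq_iff]
    tauto
  have hiso : ∀ v, ∃ w, G.Adj v w := by
    intro v
    by_cases h1 : v = a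
    · subst h1; exact hpos _ (by omega)
    by_cases h2 : v = b
    · subst h2; exact hpos _ (by omega)
    by_cases h3 : v = c
    · subst h3; exact hpos _ (by omega)
    by_cases h4 : v = d
    · subst h4; exact hpos _ (by omega)
    obtain ⟨w, hw⟩ := no_isolated R hR v
    exact ⟨w, hsame v h1 h2 h3 h4 w hw⟩
  let ε : Fin (Fintype.card V) ≃ V := (Fintype.equivFin V).symm
  let f : G.comap ε →g H := ⟨ε, fun {x y} h => hle h⟩
  have hf : Function.Injective f := ε.injective
  have hgoodG : GoodGraph (G.comap ε) := by
    refine ⟨planar_sub R hR G hle hiso ε, ⟨?_, ε.symm x, ?_⟩, ?_, ?_, ?_⟩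
    · intro v
      rw [vdeg_comap]
      exact (vdeg_le hle _).trans (hmax _)
    · rw [vdeg_comap, Equiv.apply_symm_apply]
      apply le_antisymm ((vdeg_le hle _).trans (hmax _))
      rw [← hx]
      refine Nat.card_mono (Set.toFinite _) (fun w hw => ?_)
      refine hsame x ?_ ?_ ?_ ?_ w hw <;> (rintro rfl; omega)
    · rintro ⟨g, hg, hg'⟩
      exact hdia ⟨f ∘ g, hf.comp hg, fun u v h => f.map_adj (hg' h)⟩
    · rintro ⟨g, hg, hg'⟩
      exact hhouse ⟨f ∘ g, hf.comp hg, fun u v h => f.map_adj (hg' h)⟩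
    · intro v hv
      rw [vdeg_comap] at hv
      have hv' : vdeg H (f v) = 6 :=
        le_antisymm (hmax _) (hv ▸ vdeg_le hle _)
      rcases hgood (f v) hv' with h | h
      · exact Or.inl fun h' => h (two4_map f hf v h')
      · exact Or.inr fun p q l hp h' => h p q l hp (three_map f hf v p q l h')
  have hcol : TotallyColorable (G.comap ε) 7 := by
    by_contra hno
    have h1 := hm _ _ hgoodG hno
    have h2 : Nat.card (G.comap ε).edgeSet = Nat.card G.edgeSet :=
      Nat.card_congr (SimpleGraph.Iso.comap ε G).mapEdgeSet
    have h3 : Nat.card G.edgeSet < Nat.card H.edgeSet := by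
      rw [Nat.card_coe_set_eq, Nat.card_coe_set_eq]
      refine Set.ncard_lt_ncard ?_ (Set.toFinite _)
      rw [SimpleGraph.edgeSet_ssubset_edgeSet]
      refine lt_of_le_of_ne hle ?_
      intro h
      rw [h] at da
      omega
    omega
  apply hnot
  apply extend_coloring H a b c d hab hbc hcd hda hac hbd ha hb hc hd
  obtain ⟨cv, ce, h1, h2, h3⟩ := hcol
  have hadj : ∀ u v, G.Adj u v → (G.comap ε).Adj (ε.symm u) (ε.symm v) := by
    intro u v h; simpa using h
  refine ⟨fun v => cv (ε.symm v), fun e => ce (e.map ε.symm), ?_, ?_, ?_⟩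
  · intro u v h; exact h1 (hadj u v h)
  · rintro e he e' he' hne ⟨y, hy, hy'⟩
    refine h2 _ ?_ _ ?_ (fun h => hne (Sym2.map.injective ε.symm.injective h))
      ⟨ε.symm y, Sym2.mem_map.2 ⟨y, hy, rfl⟩, Sym2.mem_map.2 ⟨y, hy', rfl⟩⟩
    · induction e with | _ u v
      exact hadj u v he
    · induction e' with | _ u v
      exact hadj u v he'
  · intro u v h; exact h3 (hadj u v h)

theorem sigma_fix {V : Type*} [Finite V] {H : SimpleGraph V} (R : RotationSystem H) (x : H.Dart)
    (h : R.σ x = x) : vdeg H x.fst ≤ 1 := by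
  unfold vdeg
  rw [Finite.card_le_one_iff_subsingleton]
  have key : ∀ w, H.Adj x.fst w → w = x.snd := by
    intro w hw
    have h1 := R.vertex_cycles x ⟨(x.fst, w), hw⟩ rfl
    have h2 := (Equiv.Perm.SameCycle.eq_of_left h1 h)
    exact (congrArg (fun y : H.Dart => y.snd) h2).symm
  constructor
  rintro ⟨w, hw⟩ ⟨w', hw'⟩
  exact Subtype.ext ((key w hw).trans (key w' hw').symm)

end Aux4

/-- **Lemma.** A minimal counterexample has no (3,5,3,5)-face: no 4-face whose incident
vertices in cyclic order along the boundary have degrees 3, 5, 3, 5. -/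
theorem minimal_counterexample_no_3535_face
    {V : Type*} [Fintype V] (H : SimpleGraph V)
    (hmin : MinimalCounterexample H)
    (R : RotationSystem H) (hR : R.IsPlanarEmbedding) :
    ¬ ∃ d : H.Dart, R.faceDeg d = 4 ∧
      vdeg H d.fst = 3 ∧ vdeg H (R.φ d).fst = 5 ∧
      vdeg H (R.φ (R.φ d)).fst = 3 ∧ vdeg H (R.φ (R.φ (R.φ d))).fst = 5 := by
  rintro ⟨d, hdeg, h1, h2, h3, h4⟩
  classical
  have hstep : ∀ x : H.Dart, (R.φ x).fst = x.snd := fun x => R.tail_fixed x.symm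
  have hφ : ∀ x : H.Dart, R.φ x = R.σ x.symm := fun x => rfl
  have hadj : ∀ x : H.Dart, H.Adj x.fst (R.φ x).fst := fun x => by
    rw [hstep]; exact x.adj
  -- an immediate backtrack forces a vertex of degree one
  have hback : ∀ x : H.Dart, (R.φ (R.φ x)).fst = x.fst → vdeg H (R.φ x).fst ≤ 1 := by
    intro x hx
    have hx2 : R.φ x = x.symm := by
      apply SimpleGraph.Dart.ext
      apply Prod.ext
      · exact hstep x
      · rw [← hstep (R.φ x)]; exact hx
    have := sigma_fix R x.symm (by rw [← hφ]; exact hx2)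
    rw [hstep]; exact this
  have h5 : R.φ (R.φ (R.φ (R.φ d))) = d := by
    by_cases hfix : R.φ d = d
    · rw [hfix, hfix, hfix, hfix]
    have hset : R.faceDarts d = ((R.φ.cycleOf d).support : Set H.Dart) := by
      ext y
      rw [Finset.mem_coe, Equiv.Perm.mem_support_cycleOf_iff, Equiv.Perm.mem_support]
      exact ⟨fun h => ⟨h, hfix⟩, fun h => h.1⟩
    have hcard : (R.φ.cycleOf d).support.card = 4 := by
      rw [← hdeg, RotationSystem.faceDeg, hset, Set.ncard_coe_finset]
    have := Equiv.Perm.pow_mod_card_support_cycleOf_self_apply R.φ 4 d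
    rw [hcard] at this
    exact this.symm
  have hac : d.fst ≠ (R.φ (R.φ d)).fst := fun h => by
    have := hback d h.symm
    omega
  have hbd : (R.φ d).fst ≠ (R.φ (R.φ (R.φ d))).fst := fun h => by
    have := hback (R.φ d) h.symm
    omega
  refine main_core H hmin R hR _ _ _ _ (hadj d) (hadj _) (hadj _) ?_ hac hbd h1 h2 h3 h4
  have := hadj (R.φ (R.φ (R.φ d)))
  rwa [h5] at this
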